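/- arXiv:1611.06687 — 3 statements merged into one kernel-verified Lean document; each statement's English description precedes it below -/
import Mathlib

section
/- Let κ and c be positive integers with c even, set d = κ²·c, and assume d ≡ 2 (mod 6). Then for every integer n the following are equivalent: (i) the residue class of n in ℤ/dℤ has additive order κ and 6d divides n²·(2d−1); (ii) there exists an integer a coprime to κ such that n ≡ a·κ·c (mod d). In other words, the isotropic elements of order κ of the finite quadratic form q on ℤ/dℤ are exactly the classes (a·κ·c)·g with a a unit modulo κ. -/
/-- The additive order of an integer in `ZMod d`, for `d` nonzero. -/
theorem ZMod.addOrderOf_intCast_eq_div_gcd {d : ℕ} (hd : d ≠ 0) (n : ℤ) :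
    addOrderOf (n : ZMod d) = d / d.gcd n.natAbs := by
  rw [← ZMod.addOrderOf_coe n.natAbs hd]
  rcases Int.natAbs_eq n with h | h
  · conv_lhs => rw [h, Int.cast_natCast]
  · conv_lhs => rw [h, Int.cast_neg, Int.cast_natCast, addOrderOf_neg]

/-- The elements of additive order `k` in `ZMod (k * l)` are the multiples of `l` by
integers coprime to `k`. -/
theorem ZMod.addOrderOf_intCast_mul_eq_left_iff {k l : ℕ} (hk : 0 < k) (hl : 0 < l) (n : ℤ) :
    addOrderOf (n : ZMod (k * l)) = k ↔ ∃ m : ℤ, IsCoprime m (k : ℤ) ∧ n = m * l := by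
  rw [ZMod.addOrderOf_intCast_eq_div_gcd (by positivity)]
  constructor
  · intro h
    have hgcd : (k * l).gcd n.natAbs = l := by
      have hmul := Nat.div_mul_cancel (Nat.gcd_dvd_left (k * l) n.natAbs)
      rw [h] at hmul
      exact Nat.eq_of_mul_eq_mul_left hk hmul
    have hdvd : (l : ℤ) ∣ n := Int.natCast_dvd.mpr (hgcd ▸ Nat.gcd_dvd_right _ _)
    obtain ⟨m, rfl⟩ := hdvd
    refine ⟨m, ?_, mul_comm _ _⟩
    rw [Int.natAbs_mul, Int.natAbs_natCast, mul_comm k, Nat.gcd_mul_left] at hgcd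
    rw [isCoprime_comm, Int.isCoprime_iff_gcd_eq_one]
    exact Nat.eq_of_mul_eq_mul_left hl (hgcd.trans (mul_one l).symm)
  · rintro ⟨m, hm, rfl⟩
    rw [isCoprime_comm, Int.isCoprime_iff_gcd_eq_one] at hm
    have hm' : k.gcd m.natAbs = 1 := hm
    rw [Int.natAbs_mul, Int.natAbs_natCast, Nat.gcd_mul_right, hm', one_mul,
      Nat.mul_div_cancel _ hl]

/-- Isotropic elements of order `κ` of the discriminant quadratic form on `ℤ/dℤ`
(case `d ≡ 2 (mod 6)`): for `d = κ²·c` with `c` even, the classes `n` of additive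
order `κ` with `6d ∣ n²(2d−1)` are exactly those of the form `a·κ·c` with `a` a
unit modulo `κ`. -/
theorem isotropic_order_kappa_d_two_mod_six
    (κ c : ℕ) (hκ : 0 < κ) (hc : 0 < c) (hceven : Even c)
    (d : ℕ) (hd : d = κ ^ 2 * c) (hmod : d % 6 = 2) :
    ∀ n : ℤ,
      (addOrderOf ((n : ℤ) : ZMod d) = κ ∧ (6 * (d : ℤ)) ∣ n ^ 2 * (2 * (d : ℤ) - 1)) ↔
      ∃ a : ℤ, IsCoprime a (κ : ℤ) ∧ n ≡ a * κ * c [ZMOD (d : ℤ)] := by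
  intro n
  have hdk : d = κ * (κ * c) := by rw [hd]; ring
  have horder : addOrderOf (n : ZMod d) = κ ↔
      ∃ m : ℤ, IsCoprime m (κ : ℤ) ∧ n = m * ((κ * c : ℕ) : ℤ) := by
    rw [hdk]
    exact ZMod.addOrderOf_intCast_mul_eq_left_iff hκ (by positivity) n
  rw [horder]
  constructor
  · rintro ⟨⟨m, hm, rfl⟩, -⟩
    refine ⟨m, hm, ?_⟩
    rw [Nat.cast_mul, mul_assoc]
  · rintro ⟨a, ha, hn⟩
    obtain ⟨t, ht⟩ := hn.symm.dvd
    have hdz : (d : ℤ) = κ ^ 2 * c := by exact_mod_cast hd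
    have hnm : n = (a + κ * t) * ((κ * c : ℕ) : ℤ) := by
      push_cast
      linear_combination ht + t * hdz
    refine ⟨⟨a + κ * t, ha.add_mul_left_left t, hnm⟩, ?_⟩
    obtain ⟨e, he⟩ := hceven
    obtain ⟨f, hf⟩ : (3 : ℤ) ∣ 2 * (d : ℤ) - 1 := by omega
    have hcz : (c : ℤ) = e + e := by exact_mod_cast he
    have hsq : n ^ 2 = 2 * d * (e * (a + κ * t) ^ 2) := by
      rw [hnm, hdz]
      push_cast
      rw [hcz]
      ring
    refine ⟨e * (a + κ * t) ^ 2 * f, ?_⟩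
    rw [hsq, hf]
    ring
end

section
/- Let κ and c be positive integers with c even, set d = κ²·c, and assume d ≡ 0 (mod 6) and 9 ∤ d. Then for every integer n the following are equivalent: (i) the residue class of n in ℤ/dℤ has additive order κ and 6d divides n²·(2d−9); (ii) there exists an integer a coprime to κ such that n ≡ a·κ·c (mod d). In other words, the isotropic elements of order κ of the finite quadratic form q on ℤ/dℤ are exactly the classes (a·κ·c)·g with a a unit modulo κ. -/
/-- The class of `b * m` in `ℤ/(k * m)ℤ` has additive order `k` exactly when `b` is coprime
to `k`. -/
theorem ZMod.addOrderOf_intCast_mul_eq_iff_isCoprime {k m : ℕ} (hk : 0 < k) (hm : 0 < m)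
    (b : ℤ) : addOrderOf ((b * m : ℤ) : ZMod (k * m)) = k ↔ IsCoprime b (k : ℤ) := by
  have hdvd (j : ℕ) : addOrderOf ((b * m : ℤ) : ZMod (k * m)) ∣ j ↔ (k : ℤ) ∣ j * b := by
    have hcast : j • ((b * m : ℤ) : ZMod (k * m)) = ((j * b * m : ℤ) : ZMod (k * m)) := by
      push_cast
      rw [nsmul_eq_mul]
      ring
    rw [addOrderOf_dvd_iff_nsmul_eq_zero, hcast, ZMod.intCast_zmod_eq_zero_iff_dvd]
    push_cast
    exact mul_dvd_mul_iff_right (by exact_mod_cast hm.ne')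
  constructor
  · intro h
    obtain ⟨s, hs⟩ : b.gcd k ∣ k := Int.natCast_dvd_natCast.mp (Int.gcd_dvd_right b k)
    obtain ⟨t, ht⟩ := Int.gcd_dvd_left b k
    have hks : k ∣ s := by
      rw [← h, hdvd]
      refine ⟨t, ?_⟩
      have hs' : (k : ℤ) = b.gcd k * s := by exact_mod_cast hs
      calc (s : ℤ) * b = s * (b.gcd k * t) := by rw [← ht]
        _ = b.gcd k * s * t := by ring
        _ = k * t := by rw [← hs']
    have hsk : s ∣ k := ⟨b.gcd k, by rw [mul_comm]; exact hs⟩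
    have hsk' : s = k := Nat.dvd_antisymm hsk hks
    rw [Int.isCoprime_iff_gcd_eq_one]
    rw [hsk'] at hs
    exact Nat.eq_of_mul_eq_mul_right hk (by rw [one_mul]; exact hs.symm)
  · intro h
    refine Nat.dvd_antisymm ((hdvd k).mpr (dvd_mul_right _ _)) ?_
    exact Int.natCast_dvd_natCast.mp (h.symm.dvd_of_dvd_mul_right ((hdvd _).mp dvd_rfl))

/-- If `9 ∤ κ² * c` and `3 ∣ κ² * c`, then already `3 ∣ c`. -/
theorem Nat.three_dvd_of_three_dvd_sq_mul {κ c : ℕ} (h3 : 3 ∣ κ ^ 2 * c)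
    (h9 : ¬ 9 ∣ κ ^ 2 * c) : 3 ∣ c := by
  refine (Nat.prime_three.dvd_mul.mp h3).resolve_left fun h ↦ h9 ?_
  exact (pow_dvd_pow_of_dvd (Nat.prime_three.dvd_of_dvd_pow h) 2).mul_right c

/-- Isotropic elements of order `κ` of the discriminant quadratic form on `ℤ/dℤ`
(case `d ≡ 0 (mod 6)`, `9 ∤ d`): for `d = κ²·c` with `c` even, the classes `n` of
additive order `κ` with `6d ∣ n²(2d−9)` are exactly those of the form `a·κ·c`
with `a` a unit modulo `κ`. -/
theorem isotropic_order_kappa_d_zero_mod_six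
    (κ c : ℕ) (hκ : 0 < κ) (hc : 0 < c) (hceven : Even c)
    (d : ℕ) (hd : d = κ ^ 2 * c) (hmod : d % 6 = 0) (h9 : ¬ (9 ∣ d)) :
    ∀ n : ℤ,
      (addOrderOf ((n : ℤ) : ZMod d) = κ ∧ (6 * (d : ℤ)) ∣ n ^ 2 * (2 * (d : ℤ) - 9)) ↔
      ∃ a : ℤ, IsCoprime a (κ : ℤ) ∧ n ≡ a * κ * c [ZMOD (d : ℤ)] := by
  intro n
  have hdm : d = κ * (κ * c) := by rw [hd]; ring
  have hm : 0 < κ * c := Nat.mul_pos hκ hc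
  have h6 : 6 ∣ c := by
    have h3 : 3 ∣ c := Nat.three_dvd_of_three_dvd_sq_mul (κ := κ) (by omega) (hd ▸ h9)
    have h2 : 2 ∣ c := hceven.two_dvd
    omega
  have horder (b : ℤ) : addOrderOf ((b * κ * c : ℤ) : ZMod d) = κ ↔ IsCoprime b (κ : ℤ) := by
    rw [hdm, ← ZMod.addOrderOf_intCast_mul_eq_iff_isCoprime hκ hm b]
    push_cast
    rw [mul_assoc]
  constructor
  · rintro ⟨h, -⟩
    have hn : (d : ℤ) ∣ κ * n := by
      rw [← ZMod.intCast_zmod_eq_zero_iff_dvd]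
      have h0 := addOrderOf_nsmul_eq_zero ((n : ℤ) : ZMod d)
      rw [h, nsmul_eq_mul] at h0
      exact_mod_cast h0
    obtain ⟨b, rfl⟩ : (κ * c : ℤ) ∣ n := by
      rw [hdm] at hn
      push_cast at hn
      exact (mul_dvd_mul_iff_left (by exact_mod_cast hκ.ne')).mp hn
    rw [show (κ * c * b : ℤ) = b * κ * c by ring] at h ⊢
    exact ⟨b, (horder b).mp h, Int.ModEq.refl _⟩
  · rintro ⟨a, ha, hn⟩
    refine ⟨?_, ?_⟩
    · rw [(ZMod.intCast_eq_intCast_iff n (a * κ * c) d).mpr hn]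
      exact (horder a).mpr ha
    · obtain ⟨k, hk⟩ := hn.symm.dvd
      obtain ⟨e, rfl⟩ := h6
      obtain rfl : n = a * κ * (6 * e : ℕ) + d * k := by linarith
      refine ⟨e * (a + κ * k) ^ 2 * (2 * d - 9), ?_⟩
      rw [hd]
      push_cast
      ring
end

section
/- Let κ and c be positive integers with c even, set d = κ²·c, and assume either d ≡ 2 (mod 6), in which case set e = 2d−1, or d ≡ 0 (mod 6) and 9 ∤ d, in which case set e = 2d−9. Then the number of integers n with 0 ≤ n < d such that the class of n in ℤ/dℤ has additive order κ and 6d divides n²·e is exactly φ(κ), Euler's totient of κ. -/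
/-- Residues `n < d` satisfying a property of their class are counted by the classes. -/
lemma card_subtype_lt_eq_card_zmod (d : ℕ) [NeZero d] (P : ZMod d → Prop) :
    Nat.card {n : ℕ // n < d ∧ P ((n : ℤ) : ZMod d)} = Nat.card {a : ZMod d // P a} := by
  refine Nat.card_congr
    { toFun := fun n => ⟨((n.1 : ℤ) : ZMod d), n.2.2⟩
      invFun := fun a => ⟨a.1.val, ZMod.val_lt _, by simpa using a.2⟩
      left_inv := fun n => ?_
      right_inv := fun a => ?_ }
  · ext
    simpa using ZMod.val_cast_of_lt n.2.1
  · ext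
    simp

/-- If the class of `n` modulo `κ² c` has order `κ`, then `κ c` divides `n`. -/
lemma mul_dvd_of_addOrderOf_eq {κ c n : ℕ} (hκ : 0 < κ)
    (h : addOrderOf ((n : ℤ) : ZMod (κ ^ 2 * c)) = κ) : κ * c ∣ n := by
  have h0 := addOrderOf_nsmul_eq_zero ((n : ℤ) : ZMod (κ ^ 2 * c))
  rw [h, nsmul_eq_mul, Int.cast_natCast, ← Nat.cast_mul, ZMod.natCast_eq_zero_iff] at h0
  refine Nat.dvd_of_mul_dvd_mul_left hκ ?_
  rwa [← mul_assoc, ← sq]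

/-- Elements of order `κ` are isotropic as soon as `c` is even and `3 ∣ e`. -/
lemma six_mul_dvd_sq_mul_of_addOrderOf_eq {κ c n : ℕ} {e : ℤ} (hκ : 0 < κ) (hc : Even c)
    (he : 3 ∣ e) (h : addOrderOf ((n : ℤ) : ZMod (κ ^ 2 * c)) = κ) :
    6 * ((κ ^ 2 * c : ℕ) : ℤ) ∣ (n : ℤ) ^ 2 * e := by
  obtain ⟨m, rfl⟩ := mul_dvd_of_addOrderOf_eq hκ h
  obtain ⟨k, rfl⟩ := hc
  obtain ⟨f, rfl⟩ := he
  exact ⟨k * m ^ 2 * f, by push_cast; ring⟩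

/-- The set of isotropic elements of order `κ` of the discriminant quadratic form
on the cyclic group `ℤ/dℤ` of order `d = κ²·c` has exactly `φ(κ)` elements. -/
theorem card_isotropic_order_kappa
    (κ c : ℕ) (hκ : 0 < κ) (hc : 0 < c) (hceven : Even c)
    (d : ℕ) (hd : d = κ ^ 2 * c) (e : ℤ)
    (he : (d % 6 = 2 ∧ e = 2 * (d : ℤ) - 1) ∨
          (d % 6 = 0 ∧ ¬ (9 ∣ d) ∧ e = 2 * (d : ℤ) - 9)) :
    Nat.card {n : ℕ // n < d ∧ addOrderOf ((n : ℤ) : ZMod d) = κ ∧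
      (6 * (d : ℤ)) ∣ (n : ℤ) ^ 2 * e} = Nat.totient κ := by
  have h3 : (3 : ℤ) ∣ e := by omega
  subst hd
  have : NeZero (κ ^ 2 * c) := ⟨by positivity⟩
  have hiff (n : ℕ) : (n < κ ^ 2 * c ∧ addOrderOf ((n : ℤ) : ZMod (κ ^ 2 * c)) = κ ∧
      6 * ((κ ^ 2 * c : ℕ) : ℤ) ∣ (n : ℤ) ^ 2 * e) ↔
      n < κ ^ 2 * c ∧ addOrderOf ((n : ℤ) : ZMod (κ ^ 2 * c)) = κ :=
    and_congr_right fun _ => and_iff_left_of_imp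
      (six_mul_dvd_sq_mul_of_addOrderOf_eq hκ hceven h3)
  rw [Nat.card_congr (Equiv.subtypeEquivRight hiff),
    card_subtype_lt_eq_card_zmod _ (fun a => addOrderOf a = κ), Nat.card_eq_fintype_card,
    Fintype.card_subtype]
  refine IsAddCyclic.card_addOrderOf_eq_totient ?_
  rw [ZMod.card]
  exact (dvd_pow_self κ two_ne_zero).mul_right c
end
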